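/- arXiv:2507.05434 — 3 statements merged into one kernel-verified Lean document; each statement's English description precedes it below -/
import Mathlib

section
/- Let F be a field, let n ≥ 1, and let t_0, …, t_n ∈ F be pairwise distinct elements. Then for each fixed index i ∈ {0, …, n}, the sum over all s ≠ i of the products ∏_{l ∉ {i,s}} (t_l − t_i)/(t_s − t_l) equals (−1)^{n−1}; that is, ∑_{s ≠ i} ∏_{l ≠ i, l ≠ s} (t_l − t_i)/(t_s − t_l) = (−1)^{n−1}. -/
/-- The values at a point `x` of the Lagrange basis polynomials sum to one; here each factor of the
numerators is written with the opposite sign. -/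
theorem sum_prod_sub_div_sub {F ι : Type*} [Field F] [DecidableEq ι] {s : Finset ι} {v : ι → F}
    (hvs : Set.InjOn v s) (hs : s.Nonempty) (x : F) :
    ∑ j ∈ s, ∏ l ∈ s.erase j, (v l - x) / (v j - v l) = (-1 : F) ^ (s.card - 1) := by
  have hbasis := congrArg (Polynomial.eval x) (Lagrange.sum_basis hvs hs)
  rw [Polynomial.eval_finsetSum, Polynomial.eval_one] at hbasis
  refine Eq.trans ?_ ((congrArg ((-1 : F) ^ (s.card - 1) * ·) hbasis).trans (mul_one _))
  rw [Finset.mul_sum]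
  refine Finset.sum_congr rfl fun j hj => ?_
  rw [← Finset.card_erase_of_mem hj, Lagrange.basis, Polynomial.eval_prod, ← Finset.prod_const,
    ← Finset.prod_mul_distrib]
  refine Finset.prod_congr rfl fun l _ => ?_
  simp only [Lagrange.basisDivisor, Polynomial.eval_mul, Polynomial.eval_C, Polynomial.eval_sub,
    Polynomial.eval_X]
  ring

/-- **Lagrange-interpolation identity** from the proof of Proposition 3.3:
for pairwise distinct `t 0, …, t n` in a field `F` and any fixed index `i`,
`∑_{s ≠ i} ∏_{l ∉ {i,s}} (t l − t i)/(t s − t l) = (−1)^(n−1)`. -/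
theorem stmt_0 (F : Type*) [Field F] (n : ℕ) (hn : 1 ≤ n)
    (t : Fin (n + 1) → F) (ht : Function.Injective t) (i : Fin (n + 1)) :
    ∑ s ∈ Finset.univ.erase i, ∏ l ∈ (Finset.univ.erase i).erase s,
      (t l - t i) / (t s - t l) = (-1 : F) ^ (n - 1) := by
  have hcard : (Finset.univ.erase i).card = n := by simp
  have h := sum_prod_sub_div_sub (s := Finset.univ.erase i) ht.injOn
    (Finset.card_pos.mp (by omega)) (t i)
  rwa [hcard] at h
end

section
/- Let k be a field, let α_0, …, α_n ∈ k be pairwise distinct, and let x, y : Fin (n+1) → k be vectors with x ≠ 0, y ≠ 0 and ∑_{l=0}^{n} x_l y_l = 0. Then the 2 × (2n+2) matrix whose first row is (y_0, …, y_n, x_0, …, x_n) and whose second row is (α_0 y_0, …, α_n y_n, α_0 x_0, …, α_n x_n) has rank 2. -/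
/-- Jacobian-criterion computation of Lemma 3.1: for pairwise distinct `α l` and
nonzero vectors `x, y` with `∑ x l * y l = 0`, the `2 × (2n+2)` Jacobian matrix
with rows `(y, x)` and `(α·y, α·x)` has rank `2`. -/
theorem stmt_3 (k : Type*) [Field k] (n : ℕ) (α : Fin (n + 1) → k)
    (hα : Function.Injective α) (x y : Fin (n + 1) → k) (hx : x ≠ 0) (hy : y ≠ 0)
    (hxy : ∑ l, x l * y l = 0) :
    (Matrix.of ![Sum.elim y x,
        Sum.elim (fun l => α l * y l) (fun l => α l * x l)] :
      Matrix (Fin 2) (Fin (n + 1) ⊕ Fin (n + 1)) k).rank = 2 := by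
  refine (LinearIndependent.rank_matrix ?_).trans (Fintype.card_fin 2)
  change LinearIndependent k ![Sum.elim y x,
    Sum.elim (fun l => α l * y l) (fun l => α l * x l)]
  rw [LinearIndependent.pair_iff]
  intro a b h
  have root_of_y_ne (l) (hl : y l ≠ 0) : a + b * α l = 0 := by
    have hcol := congrFun h (Sum.inl l)
    simp only [Pi.add_apply, Pi.smul_apply, Sum.elim_inl, smul_eq_mul, Pi.zero_apply] at hcol
    exact (mul_eq_zero.mp (by linear_combination hcol : (a + b * α l) * y l = 0)).resolve_right hl
  have root_of_x_ne (l) (hl : x l ≠ 0) : a + b * α l = 0 := by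
    have hcol := congrFun h (Sum.inr l)
    simp only [Pi.add_apply, Pi.smul_apply, Sum.elim_inr, smul_eq_mul, Pi.zero_apply] at hcol
    exact (mul_eq_zero.mp (by linear_combination hcol : (a + b * α l) * x l = 0)).resolve_right hl
  obtain ⟨i, hi⟩ := Function.ne_iff.mp hx
  obtain ⟨j, hj⟩ := Function.ne_iff.mp hy
  have hb : b = 0 := by
    by_contra hb
    have root_unique (l m) (hl : a + b * α l = 0) (hm : a + b * α m = 0) : l = m :=
      hα (mul_left_cancel₀ hb (by linear_combination hl - hm))
    obtain rfl := root_unique i j (root_of_x_ne i hi) (root_of_y_ne j hj)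
    rw [Fintype.sum_eq_single i fun l hl => ?_] at hxy
    · exact mul_ne_zero hi hj hxy
    · by_contra hne
      exact hl (root_unique l i (root_of_x_ne l (left_ne_zero_of_mul hne)) (root_of_x_ne i hi))
  exact ⟨by simpa [hb] using root_of_y_ne j hj, hb⟩
end

section
/- Let k be a field, let K/k be a finite Galois extension, and let B be a commutative k-algebra such that there is a K-algebra isomorphism K ⊗_k B ≅ K^{n+1} (functions Fin (n+1) → K with pointwise operations). Suppose moreover that every k-algebra homomorphism B → K is surjective. Then [K : k] divides n+1 and, with m = (n+1)/[K : k], there is a k-algebra isomorphism B ≅ K^m (functions Fin m → K with pointwise operations, K viewed as a k-algebra). -/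
/-- A prime ideal containing a finite intersection of kernels of surjections onto a field
is one of these kernels. -/
theorem Ideal.IsPrime.exists_eq_ker_of_injective_pi {ι R K : Type*} [Finite ι] [CommRing R]
    [Field K] (f : ι → R →+* K) (hf : ∀ i, Function.Surjective (f i))
    (hinj : Function.Injective fun r i ↦ f i r) (I : Ideal R) [hI : I.IsPrime] :
    ∃ i, RingHom.ker (f i) = I := by
  have := Fintype.ofFinite ι
  have hle : Finset.univ.inf (fun i ↦ RingHom.ker (f i)) ≤ I := by
    intro r hr
    have hr0 : r = 0 := by
      refine hinj (funext fun i ↦ ?_)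
      simpa using RingHom.mem_ker.mp
        (Finset.inf_le (f := fun i ↦ RingHom.ker (f i)) (Finset.mem_univ i) hr)
    simp [hr0]
  obtain ⟨i, -, hi⟩ := (Ideal.IsPrime.inf_le' hI).mp hle
  have := RingHom.ker_isMaximal_of_surjective (f i) (hf i)
  exact ⟨i, this.eq_of_le hI.ne_top hi⟩

/-- A finite-dimensional algebra that embeds into a finite power of `K` is itself a power of `K`,
provided all its homomorphisms to `K` are surjective. -/
theorem Algebra.nonempty_algEquiv_pi_of_injective {ι k K B : Type*} [Finite ι] [Field k] [Field K]
    [Algebra k K] [CommRing B] [Algebra k B] [FiniteDimensional k B]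
    (g : B →ₐ[k] (ι → K)) (hg : Function.Injective g)
    (hsurj : ∀ f : B →ₐ[k] K, Function.Surjective f) :
    Nonempty (B ≃ₐ[k] (MaximalSpectrum B → K)) := by
  have : IsArtinianRing B := IsArtinianRing.of_finite k B
  have : IsReduced B := isReduced_of_injective g hg
  let f (i : ι) : B →ₐ[k] K := (Pi.evalAlgHom k (fun _ ↦ K) i).comp g
  have hquot (I : MaximalSpectrum B) : Nonempty ((B ⧸ I.asIdeal) ≃ₐ[k] K) := by
    have := I.isMaximal.isPrime
    obtain ⟨i, hi⟩ := Ideal.IsPrime.exists_eq_ker_of_injective_pi (fun i ↦ (f i : B →+* K))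
      (fun i ↦ hsurj (f i)) hg I.asIdeal
    exact ⟨(Ideal.quotientEquivAlgOfEq k hi.symm).trans
      (Ideal.quotientKerAlgEquivOfSurjective (hsurj (f i)))⟩
  exact ⟨((IsArtinianRing.equivPi B).restrictScalars k).trans
    (AlgEquiv.piCongrRight fun I ↦ (hquot I).some)⟩

open scoped TensorProduct

/-- Algebraic core of Lemma 3.2: if `K/k` is finite Galois, `K ⊗ₖ B ≅ K^(n+1)`
as `K`-algebras, and every `k`-algebra homomorphism `B → K` is surjective, then
`[K : k] ∣ n + 1` and `B ≅ K^m` as `k`-algebras, where `m = (n+1)/[K : k]`. -/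
theorem stmt_13 (k K : Type*) [Field k] [Field K] [Algebra k K]
    [FiniteDimensional k K] [IsGalois k K]
    (B : Type*) [CommRing B] [Algebra k B] (n : ℕ)
    (h1 : Nonempty ((K ⊗[k] B) ≃ₐ[K] (Fin (n + 1) → K)))
    (h2 : ∀ f : B →ₐ[k] K, Function.Surjective f) :
    Module.finrank k K ∣ n + 1 ∧
      Nonempty (B ≃ₐ[k] (Fin ((n + 1) / Module.finrank k K) → K)) := by
  obtain ⟨e⟩ := h1
  have hrank : Module.finrank k B = n + 1 := by
    rw [← Module.finrank_baseChange (R := K), e.toLinearEquiv.finrank_eq, Module.finrank_fin_fun]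
  have : FiniteDimensional k B := Module.finite_of_finrank_pos (by omega)
  have : IsArtinianRing B := IsArtinianRing.of_finite k B
  let g : B →ₐ[k] (Fin (n + 1) → K) :=
    (e.restrictScalars k).toAlgHom.comp Algebra.TensorProduct.includeRight
  have hg : Function.Injective g :=
    e.injective.comp (Algebra.TensorProduct.includeRight_injective (algebraMap k K).injective)
  obtain ⟨e'⟩ := Algebra.nonempty_algEquiv_pi_of_injective g hg h2
  have := Fintype.ofFinite (MaximalSpectrum B)
  have hcard : n + 1 = Fintype.card (MaximalSpectrum B) * Module.finrank k K := by
    rw [← hrank, e'.toLinearEquiv.finrank_eq, Module.finrank_pi_fintype]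
    simp
  refine ⟨Dvd.intro_left _ hcard.symm, ?_⟩
  rw [hcard, Nat.mul_div_cancel _ Module.finrank_pos]
  exact ⟨e'.trans (AlgEquiv.piCongrLeft k (fun _ ↦ K) (Fintype.equivFin _))⟩
end
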